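/- Suppose E[S] = 1 and that for some integer n' ≥ 1 and constants C_1 > 0 and r_1 ≥ s_1 > 1, for all t ≥ 1, E[|∑_{i=1}^{n'} N_i(t) − n' t|^{r_1}] ≤ C_1 n'^{r_1/2} t^{s_1}. Then for all nonnegative integers k and all λ > 0, P(max_{j ∈ {1,...,k}} |n' j − ∑_{i=1}^{n'} N_i(j)| ≥ λ) ≤ (6(r_1+1)/(s_1−1))^{r_1+1} C_1 n'^{r_1/2} k^{s_1} λ^{−r_1}. -/

import Mathlib

open MeasureTheory ProbabilityTheory
open scoped NNReal ENNReal

/-- The number of renewals in `[0, t]` of a renewal process whose successive renewal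
intervals are `ξ 0, ξ 1, ξ 2, ...`. -/
noncomputable def renewalCount (ξ : ℕ → ℝ) (t : ℝ) : ℕ :=
  sSup {n : ℕ | ∑ i ∈ Finset.range n, ξ i ≤ t}


/-- Deterministic dyadic chaining bound. -/
lemma chain_aux (x : ℕ → ℝ) (b : ℕ → ℝ) (hb : ∀ l, 0 ≤ b l) (k : ℕ)
    (h : ∀ l a, (a + 1) * 2 ^ l ≤ k → |x ((a + 1) * 2 ^ l) - x (a * 2 ^ l)| ≤ b l)
    (j : ℕ) (hj : j ≤ k) (p : ℕ) :
    |x j - x (j / 2 ^ p * 2 ^ p)| ≤ ∑ l ∈ Finset.range p, b l := by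
  induction p with
  | zero => simp
  | succ p ih =>
    rw [Finset.sum_range_succ]
    have hd : j / 2 ^ (p + 1) = (j / 2 ^ p) / 2 := by
      rw [pow_succ, Nat.div_div_eq_div_mul]
    have hle : j / 2 ^ p * 2 ^ p ≤ j := Nat.div_mul_le_self _ _
    rw [hd]
    generalize j / 2 ^ p = q at *
    have key : |x (q * 2 ^ p) - x (q / 2 * 2 ^ (p + 1))| ≤ b p := by
      rcases Nat.even_or_odd' q with ⟨c, hc | hc⟩
      · have : q / 2 * 2 ^ (p + 1) = q * 2 ^ p := by
          subst hc; rw [Nat.mul_div_cancel_left _ (by norm_num)]; ring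
        rw [this]; simpa using hb p
      · have h1 : q / 2 * 2 ^ (p + 1) = (2 * c) * 2 ^ p := by
          have : q / 2 = c := by omega
          rw [this]; ring
        rw [h1]
        subst hc
        exact h p (2 * c) (hle.trans hj)
    calc |x j - x (q / 2 * 2 ^ (p + 1))|
        = |(x j - x (q * 2 ^ p)) + (x (q * 2 ^ p) - x (q / 2 * 2 ^ (p + 1)))| := by ring_nf
      _ ≤ _ := (abs_add_le _ _).trans (add_le_add ih key)

lemma rho_aux {r s : ℝ} (hs : 1 < s) (hr : s ≤ r) :
    ∃ ρ : ℝ, ρ = (2 : ℝ) ^ (-((s - 1) / (r + 1))) ∧ 0 < ρ ∧ ρ < 1 ∧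
      (1 - ρ)⁻¹ ≤ 6 * (r + 1) / (s - 1) := by
  refine ⟨_, rfl, by positivity, ?_, ?_⟩
  · apply Real.rpow_lt_one_of_one_lt_of_neg (by norm_num)
    have : 0 < (s - 1) / (r + 1) := div_pos (by linarith) (by linarith)
    linarith
  · set y := (s - 1) / (r + 1) with hy
    have hy0 : 0 < y := div_pos (by linarith) (by linarith)
    have hy1 : y ≤ 1 := by rw [hy, div_le_one (by linarith)]; linarith
    have h1 : (2 : ℝ) ^ (-y) ≤ 1 - y / 2 := by
      have := rpow_one_add_le_one_add_mul_self (s := -(1/2)) (by norm_num) hy0.le hy1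
      have e : (2 : ℝ) ^ (-y) = (1 + -(1/2)) ^ y := by
        rw [Real.rpow_neg (by norm_num), ← Real.inv_rpow (by norm_num)]; norm_num
      rw [e]; linarith
    have h2 : 6 * (r + 1) / (s - 1) = (y / 6)⁻¹ := by
      rw [hy]; field_simp
    rw [h2]
    apply inv_anti₀ (by positivity)
    linarith

lemma term_aux {r s A lam ρ : ℝ} {k : ℝ} (hs : 1 < s) (hr : s ≤ r)
    (hρ : ρ = (2 : ℝ) ^ (-((s - 1) / (r + 1)))) (hρ0 : 0 < ρ) (hρ1 : ρ < 1) (hlam : 0 < lam)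
    (l d : ℕ) :
    k / 2 ^ l * (A * ((2 : ℝ) ^ l) ^ s * (lam * (1 - ρ) * ρ ^ d) ^ (-r))
      = (A * k * ((2 : ℝ) ^ (l + d)) ^ (s - 1) * lam ^ (-r) * (1 - ρ) ^ (-r)) * ρ ^ d := by
  have h1 : (0 : ℝ) < 1 - ρ := by linarith
  rw [Real.mul_rpow (by positivity) (by positivity), Real.mul_rpow (by positivity) h1.le]
  have e1 : ((2 : ℝ) ^ l) ^ s = 2 ^ l * ((2 : ℝ) ^ l) ^ (s - 1) := by
    rw [Real.rpow_sub (by positivity), Real.rpow_one]; field_simp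
  have e2 : (ρ ^ d) ^ (-r) = ((2 : ℝ) ^ d) ^ (s - 1) * ρ ^ d := by
    have hr0 : r + 1 ≠ 0 := by linarith
    rw [hρ]
    simp only [← Real.rpow_natCast, ← Real.rpow_mul (zero_le_two : (0 : ℝ) ≤ 2)]
    rw [← Real.rpow_add (by norm_num)]
    congr 1
    field_simp
    ring
  rw [e1, e2, pow_add, Real.mul_rpow (by positivity) (by positivity)]
  field_simp

lemma maximal_ineq {Ω : Type*} [MeasurableSpace Ω] (μ : Measure Ω)
    (X : ℕ → Ω → ℝ) (hX : ∀ j, Measurable (X j)) (hX0 : ∀ ω, X 0 ω = 0)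
    {A r s : ℝ} (hA : 0 ≤ A) (hs : 1 < s) (hr : s ≤ r)
    (hinc : ∀ i j : ℕ, 1 ≤ j → ∫⁻ ω, ENNReal.ofReal (|X (i + j) ω - X i ω| ^ r) ∂μ
      ≤ ENNReal.ofReal (A * (j : ℝ) ^ s))
    (k : ℕ) (lam : ℝ) (hlam : 0 < lam) :
    μ {ω | ∃ j : ℕ, 1 ≤ j ∧ j ≤ k ∧ lam ≤ |X j ω|}
      ≤ ENNReal.ofReal ((6 * (r + 1) / (s - 1)) ^ (r + 1) * A * (k : ℝ) ^ s * lam ^ (-r)) := by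
  rcases Nat.eq_zero_or_pos k with rfl | hk
  · have : {ω | ∃ j : ℕ, 1 ≤ j ∧ j ≤ 0 ∧ lam ≤ |X j ω|} = ∅ := by
      rw [Set.eq_empty_iff_forall_notMem]; rintro ω ⟨j, h1, h2, -⟩; omega
    rw [this]; simp
  have hr0 : 0 < r := by linarith
  obtain ⟨ρ, hρ, hρ0, hρ1, hρc⟩ := rho_aux hs hr
  have h1ρ : 0 < 1 - ρ := by linarith
  set m := Nat.log 2 k with hm
  set b : ℕ → ℝ := fun l => lam * (1 - ρ) * ρ ^ (m - l) with hb
  have hb0 : ∀ l, 0 < b l := fun l => by positivity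
  have hmk : 2 ^ m ≤ k := Nat.pow_log_le_self 2 hk.ne'
  have hkm : k < 2 ^ (m + 1) := Nat.lt_pow_succ_log_self (by norm_num) k
  -- Markov
  have markov : ∀ l a : ℕ, μ {ω | b l ≤ |X ((a + 1) * 2 ^ l) ω - X (a * 2 ^ l) ω|}
      ≤ ENNReal.ofReal (A * ((2 : ℝ) ^ l) ^ s * (b l) ^ (-r)) := by
    intro l a
    have h1 := hinc (a * 2 ^ l) (2 ^ l) Nat.one_le_two_pow
    have e : a * 2 ^ l + 2 ^ l = (a + 1) * 2 ^ l := by ring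
    rw [e] at h1
    have h2 : {ω | b l ≤ |X ((a + 1) * 2 ^ l) ω - X (a * 2 ^ l) ω|} ⊆
        {ω | ENNReal.ofReal (b l ^ r) ≤
          ENNReal.ofReal (|X ((a + 1) * 2 ^ l) ω - X (a * 2 ^ l) ω| ^ r)} := by
      intro ω hω
      exact ENNReal.ofReal_le_ofReal (Real.rpow_le_rpow (hb0 l).le hω hr0.le)
    refine (measure_mono h2).trans ?_
    have hbr : 0 < b l ^ r := Real.rpow_pos_of_pos (hb0 l) _
    refine (meas_ge_le_lintegral_div ?_ ?_ ENNReal.ofReal_ne_top).trans ?_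
    · have := hX ((a + 1) * 2 ^ l); have := hX (a * 2 ^ l)
      fun_prop
    · simpa using hbr
    · rw [Real.rpow_neg (hb0 l).le, ← div_eq_mul_inv, ENNReal.ofReal_div_of_pos hbr]
      gcongr
      simpa using h1
  -- inclusion
  have hsub : {ω | ∃ j : ℕ, 1 ≤ j ∧ j ≤ k ∧ lam ≤ |X j ω|} ⊆
      ⋃ l ∈ Finset.range (m + 1), ⋃ a ∈ Finset.range (k / 2 ^ l),
        {ω | b l ≤ |X ((a + 1) * 2 ^ l) ω - X (a * 2 ^ l) ω|} := by
    rintro ω ⟨j, hj1, hjk, hj⟩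
    by_contra hcon
    simp only [Set.mem_iUnion, not_exists, Set.mem_ofPred_eq, not_le, Finset.mem_range] at hcon
    have hc := chain_aux (fun j => X j ω) b (fun l => (hb0 l).le) k (by
      intro l a hla
      have hlm : l < m + 1 := by
        by_contra hlm
        have : 2 ^ (m + 1) ≤ 2 ^ l := Nat.pow_le_pow_right (by norm_num) (by omega)
        have : 1 * 2 ^ l ≤ (a + 1) * 2 ^ l := Nat.mul_le_mul_right _ (by omega)
        omega
      have hak : a < k / 2 ^ l := by
        have := (Nat.le_div_iff_mul_le (Nat.two_pow_pos l)).2 hla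
        omega
      exact (hcon l hlm a hak).le) j hjk (m + 1)
    have h0 : j / 2 ^ (m + 1) = 0 := Nat.div_eq_of_lt (by omega)
    simp only [h0, zero_mul, hX0, sub_zero] at hc
    have hsum : ∑ l ∈ Finset.range (m + 1), b l = lam * (1 - ρ ^ (m + 1)) := by
      have := Finset.sum_range_reflect (fun d => lam * (1 - ρ) * ρ ^ d) (m + 1)
      have e2 : ∑ l ∈ Finset.range (m + 1), b l
          = ∑ d ∈ Finset.range (m + 1), lam * (1 - ρ) * ρ ^ d := by
        rw [← this]
        apply Finset.sum_congr rfl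
        intro l hl
        simp [hb]
      rw [e2, ← Finset.mul_sum]
      have := mul_neg_geom_sum ρ (m + 1)
      rw [mul_assoc, this]
    rw [hsum] at hc
    have : 0 < lam * ρ ^ (m + 1) := by positivity
    linarith
  calc _ ≤ _ := measure_mono hsub
    _ ≤ ∑ l ∈ Finset.range (m + 1), μ (⋃ a ∈ Finset.range (k / 2 ^ l),
        {ω | b l ≤ |X ((a + 1) * 2 ^ l) ω - X (a * 2 ^ l) ω|}) := measure_biUnion_finset_le _ _
    _ ≤ ∑ l ∈ Finset.range (m + 1), ∑ a ∈ Finset.range (k / 2 ^ l),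
        ENNReal.ofReal (A * ((2 : ℝ) ^ l) ^ s * (b l) ^ (-r)) := by
        gcongr with l hl
        refine (measure_biUnion_finset_le _ _).trans ?_
        gcongr with a ha
        exact markov l a
    _ ≤ ∑ l ∈ Finset.range (m + 1), ENNReal.ofReal
        ((A * k * ((2 : ℝ) ^ m) ^ (s - 1) * lam ^ (-r) * (1 - ρ) ^ (-r)) * ρ ^ (m - l)) := by
        gcongr with l hl
        have hl' : l ≤ m := by simpa [Nat.lt_succ_iff] using hl
        have hp : 0 ≤ A * ((2 : ℝ) ^ l) ^ s * (b l) ^ (-r) := by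
          have := hb0 l; positivity
        rw [Finset.sum_const, Finset.card_range, nsmul_eq_mul,
          ← ENNReal.ofReal_natCast, ← ENNReal.ofReal_mul (by positivity)]
        apply ENNReal.ofReal_le_ofReal
        have := term_aux (A := A) (k := k) hs hr hρ hρ0 hρ1 hlam l (m - l)
        rw [Nat.add_sub_cancel' hl'] at this
        rw [← this]
        gcongr
        have := @Nat.cast_div_le ℝ _ _ _ k (2 ^ l)
        simpa using this
    _ = ENNReal.ofReal (∑ l ∈ Finset.range (m + 1),
        (A * k * ((2 : ℝ) ^ m) ^ (s - 1) * lam ^ (-r) * (1 - ρ) ^ (-r)) * ρ ^ (m - l)) := by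
        rw [ENNReal.ofReal_sum_of_nonneg]
        intro l _
        positivity
    _ ≤ _ := by
        apply ENNReal.ofReal_le_ofReal
        rw [← Finset.mul_sum]
        have hgeo : ∑ l ∈ Finset.range (m + 1), ρ ^ (m - l) ≤ (1 - ρ)⁻¹ := by
          have e2 := Finset.sum_range_reflect (fun d => ρ ^ d) (m + 1)
          have : ∑ l ∈ Finset.range (m + 1), ρ ^ (m - l) = ∑ d ∈ Finset.range (m + 1), ρ ^ d := by
            rw [← e2]; apply Finset.sum_congr rfl; intro l hl; simp
          rw [this, ← tsum_geometric_of_lt_one hρ0.le hρ1]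
          exact Summable.sum_le_tsum _ (fun i _ => by positivity)
            (summable_geometric_of_lt_one hρ0.le hρ1)
        have hpow : ((2 : ℝ) ^ m) ^ (s - 1) ≤ (k : ℝ) ^ (s - 1) := by
          apply Real.rpow_le_rpow (by positivity) (by exact_mod_cast hmk) (by linarith)
        have hkk : (k : ℝ) ^ s = k * (k : ℝ) ^ (s - 1) := by
          have : (0 : ℝ) < k := by exact_mod_cast hk
          rw [Real.rpow_sub this, Real.rpow_one]; field_simp
        have hfin : (1 - ρ) ^ (-r) * (1 - ρ)⁻¹ ≤ (6 * (r + 1) / (s - 1)) ^ (r + 1) := by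
          have : (1 - ρ) ^ (-r) * (1 - ρ)⁻¹ = ((1 - ρ)⁻¹) ^ (r + 1) := by
            rw [Real.inv_rpow h1ρ.le, Real.rpow_add h1ρ, Real.rpow_one, Real.rpow_neg h1ρ.le,
              mul_inv]
          rw [this]
          exact Real.rpow_le_rpow (by positivity) hρc (by linarith)
        calc _ ≤ (A * k * (k : ℝ) ^ (s - 1) * lam ^ (-r) * (1 - ρ) ^ (-r)) * (1 - ρ)⁻¹ := by
              gcongr
          _ = A * (k : ℝ) ^ s * lam ^ (-r) * ((1 - ρ) ^ (-r) * (1 - ρ)⁻¹) := by rw [hkk]; ring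
          _ ≤ A * (k : ℝ) ^ s * lam ^ (-r) * (6 * (r + 1) / (s - 1)) ^ (r + 1) := by gcongr
          _ = _ := by ring


/-- Convolution powers of a measure on the line. -/
noncomputable def convPow (F : Measure ℝ) : ℕ → Measure ℝ
  | 0 => Measure.dirac 0
  | (p + 1) => Measure.conv (convPow F p) F

lemma convPow_prob (F : Measure ℝ) [IsProbabilityMeasure F] (p : ℕ) :
    IsProbabilityMeasure (convPow F p) := by
  induction p with
  | zero => simp only [convPow]; infer_instance
  | succ p ih => simp only [convPow]; infer_instance

lemma antitone_Ioi_meas (F : Measure ℝ) : Antitone (fun x => F (Set.Ioi x)) :=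
  fun _ _ h => measure_mono (Set.Ioi_subset_Ioi h)

lemma monotone_Iic_meas (F : Measure ℝ) : Monotone (fun x => F (Set.Iic x)) :=
  fun _ _ h => measure_mono (Set.Iic_subset_Iic.2 h)

lemma nu0_eq (ν F : Measure ℝ) [IsProbabilityMeasure ν] [IsProbabilityMeasure F]
    (hν : ν (Set.Iio 0) = 0)
    (hF : ∫⁻ x in Set.Ioi 0, F (Set.Ioi x) = 1)
    (heq : ∀ y : ℝ, 0 ≤ y → (ν (Set.Ioi y)).toReal = ∫ z in Set.Ioi y, (F (Set.Ioi z)).toReal) :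
    ν = (volume.restrict (Set.Ici 0)).withDensity (fun x => F (Set.Ioi x)) := by
  have hm : Measurable (fun x => F (Set.Ioi x)) := (antitone_Ioi_meas F).measurable
  have hp : IsProbabilityMeasure
      ((volume.restrict (Set.Ici (0:ℝ))).withDensity (fun x => F (Set.Ioi x))) := by
    constructor
    rw [withDensity_apply _ MeasurableSet.univ, Measure.restrict_univ,
      ← restrict_Ioi_eq_restrict_Ici]
    exact hF
  apply Measure.ext_of_Iic
  intro a
  rcases lt_or_ge a 0 with ha | ha
  · rw [measure_mono_null (Set.Iic_subset_Iio.2 ha) hν, withDensity_apply _ measurableSet_Iic,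
      Measure.restrict_restrict measurableSet_Iic]
    have : Set.Iic a ∩ Set.Ici 0 = ∅ := by
      ext x; simp; intro h; linarith
    simp [this]
  · have e : Set.Iic a = (Set.Ioi a)ᶜ := by simp
    rw [e, prob_compl_eq_one_sub measurableSet_Ioi, prob_compl_eq_one_sub measurableSet_Ioi]
    congr 1
    rw [withDensity_apply _ measurableSet_Ioi, Measure.restrict_restrict measurableSet_Ioi]
    have : Set.Ioi a ∩ Set.Ici 0 = Set.Ioi a := by
      ext x; simp; intro h; linarith
    rw [this]
    have h1 := heq a ha
    rw [integral_toReal hm.aemeasurable (by simp)] at h1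
    refine (ENNReal.toReal_eq_toReal_iff' (by simp) ?_).1 h1
    apply ne_top_of_le_ne_top ENNReal.one_ne_top
    rw [← hF]
    exact lintegral_mono_set (Set.Ioi_subset_Ioi ha)

lemma leb_eq (ν F : Measure ℝ) [IsProbabilityMeasure ν] [IsProbabilityMeasure F]
    (hν : ν = (volume.restrict (Set.Ici 0)).withDensity (fun x => F (Set.Ioi x)))
    (hF0 : F (Set.Iio 0) = 0) :
    volume.restrict (Set.Ici (0:ℝ)) = ν + Measure.conv (volume.restrict (Set.Ici 0)) F := by
  have hm : Measurable (fun x => F (Set.Ioi x)) := (antitone_Ioi_meas F).measurable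
  have hm2 : Measurable (fun x => F (Set.Iic x)) := (monotone_Iic_meas F).measurable
  have h1 : Measure.conv (volume.restrict (Set.Ici (0:ℝ))) F
      = (volume : Measure ℝ).withDensity (fun x => F (Set.Iic x)) := by
    ext A hA
    have hind : Measurable (A.indicator (fun _ => (1:ℝ≥0∞))) := measurable_const.indicator hA
    rw [Measure.conv_comm, ← lintegral_indicator_one hA]
    change ∫⁻ z, A.indicator (fun _ => (1:ℝ≥0∞)) z ∂_ = _
    rw [Measure.lintegral_conv hind, withDensity_apply _ hA]
    have e1 : ∀ y : ℝ, ∫⁻ x in Set.Ici (0:ℝ), A.indicator (fun _ => (1:ℝ≥0∞)) (y + x)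
        = ∫⁻ x, A.indicator (fun _ => (1:ℝ≥0∞)) x * (Set.Iic x).indicator (fun _ => 1) y := by
      intro y
      rw [← lintegral_indicator measurableSet_Ici, ← lintegral_add_left_eq_self
        (μ := volume) (fun x => A.indicator (fun _ => (1:ℝ≥0∞)) x * (Set.Iic x).indicator (fun _ => 1) y) y]
      congr 1
      ext x
      simp only [Set.indicator_apply, Set.mem_Ici, Set.mem_Iic]
      by_cases hx : 0 ≤ x <;> simp [hx]
    simp_rw [e1]
    rw [lintegral_lintegral_swap]
    · rw [← lintegral_indicator hA]
      congr 1
      ext x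
      rw [lintegral_const_mul]
      · change _ * ∫⁻ y, (Set.Iic x).indicator 1 y ∂F = _
        rw [lintegral_indicator_one measurableSet_Iic]
        by_cases hx : x ∈ A <;> simp [hx]
      · exact measurable_const.indicator measurableSet_Iic
    · apply Measurable.aemeasurable
      apply Measurable.mul
      · exact hind.comp measurable_snd
      · have : (Function.uncurry fun (x y : ℝ) => (Set.Iic y).indicator (fun _ => (1:ℝ≥0∞)) x)
          = ({p : ℝ × ℝ | p.1 ≤ p.2}).indicator (fun _ => 1) := by
          ext ⟨x, y⟩
          simp [Set.indicator_apply]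
        have h3 : Measurable (({p : ℝ × ℝ | p.1 ≤ p.2}).indicator (fun _ => (1:ℝ≥0∞))) :=
          measurable_const.indicator (measurableSet_le measurable_fst measurable_snd)
        rw [← this] at h3
        exact h3
  rw [h1, hν]
  ext A hA
  rw [Measure.add_apply, withDensity_apply _ hA, withDensity_apply _ hA,
    Measure.restrict_restrict hA, Measure.restrict_apply hA]
  have e2 : ∫⁻ x in A, F (Set.Iic x) = ∫⁻ x in A ∩ Set.Ici 0, F (Set.Iic x) := by
    rw [← lintegral_inter_add_sdiff (fun x => F (Set.Iic x)) A (measurableSet_Ici (a := (0:ℝ)))]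
    have : ∫⁻ x in A \ Set.Ici 0, F (Set.Iic x) = 0 := by
      rw [setLIntegral_eq_zero_iff (hA.diff measurableSet_Ici) hm2]
      filter_upwards with x hx
      have hx0 : x < 0 := by simpa using hx.2
      exact measure_mono_null (Set.Iic_subset_Iio.2 hx0) hF0
    rw [this, add_zero]
  rw [e2, ← lintegral_add_left hm]
  have : ∀ x, F (Set.Ioi x) + F (Set.Iic x) = 1 := by
    intro x
    have := prob_add_prob_compl (μ := F) (measurableSet_Ioi (a := x))
    simpa using this
  simp [this]

lemma leb_iter (ν F : Measure ℝ) [IsProbabilityMeasure ν] [IsProbabilityMeasure F]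
    (h : volume.restrict (Set.Ici (0:ℝ)) = ν + Measure.conv (volume.restrict (Set.Ici 0)) F)
    (n : ℕ) :
    volume.restrict (Set.Ici (0:ℝ)) = ∑ k ∈ Finset.range n, Measure.conv ν (convPow F k)
      + Measure.conv (volume.restrict (Set.Ici 0)) (convPow F n) := by
  induction n with
  | zero => simp [convPow]
  | succ n ih =>
    have := convPow_prob F n
    have e : Measure.conv (volume.restrict (Set.Ici (0:ℝ))) (convPow F n)
        = Measure.conv ν (convPow F n)
          + Measure.conv (volume.restrict (Set.Ici 0)) (convPow F (n + 1)) := by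
      conv_lhs => rw [h]
      rw [Measure.add_conv, Measure.conv_assoc, Measure.conv_comm F]
      rfl
    rw [Finset.sum_range_succ, add_assoc, ← e]
    exact ih

lemma convPow_nonneg (F : Measure ℝ) [IsProbabilityMeasure F] (hF0 : F (Set.Iio 0) = 0) (p : ℕ) :
    ∀ᵐ x ∂(convPow F p), 0 ≤ x := by
  induction p with
  | zero => simp only [convPow]; rw [ae_dirac_iff measurableSet_Ici]
  | succ p ih =>
    have := convPow_prob F p
    simp only [convPow, Measure.conv]
    rw [ae_map_iff (by fun_prop) measurableSet_Ici]
    have h2 : ∀ᵐ x ∂F, 0 ≤ x := by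
      rw [ae_iff]; convert hF0 using 2; ext x; simp
    filter_upwards [Measure.quasiMeasurePreserving_fst.ae ih,
      Measure.quasiMeasurePreserving_snd.ae h2] with x h1 h2
    exact add_nonneg h1 h2

lemma leb_sum (ν F : Measure ℝ) [IsProbabilityMeasure ν] [IsProbabilityMeasure F]
    (h : volume.restrict (Set.Ici (0:ℝ)) = ν + Measure.conv (volume.restrict (Set.Ici 0)) F)
    (hlim : ∀ t : ℝ, Filter.Tendsto (fun n => ∫⁻ x, ENNReal.ofReal (t - x) ∂(convPow F n))
      Filter.atTop (nhds 0)) :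
    volume.restrict (Set.Ici (0:ℝ)) = Measure.sum (fun k => Measure.conv ν (convPow F k)) := by
  have hU : ⋃ i : ℕ, Set.Iic (i : ℝ) = Set.univ := by
    ext x; simp; exact exists_nat_ge x
  rw [Measure.ext_iff_of_iUnion_eq_univ hU]
  intro i
  ext A hA
  rw [Measure.restrict_apply hA, Measure.restrict_apply hA]
  have hB : MeasurableSet (A ∩ Set.Iic (i:ℝ)) := hA.inter measurableSet_Iic
  rw [Measure.sum_apply _ hB]
  have h1 : Filter.Tendsto (fun n => ∑ k ∈ Finset.range n,
      Measure.conv ν (convPow F k) (A ∩ Set.Iic (i:ℝ))) Filter.atTop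
      (nhds (∑' k, Measure.conv ν (convPow F k) (A ∩ Set.Iic (i:ℝ)))) :=
    ENNReal.tendsto_nat_tsum _
  have h2 : Filter.Tendsto (fun n => Measure.conv (volume.restrict (Set.Ici 0)) (convPow F n)
      (A ∩ Set.Iic (i:ℝ))) Filter.atTop (nhds 0) := by
    refine tendsto_of_tendsto_of_tendsto_of_le_of_le tendsto_const_nhds (hlim i)
      (fun _ => zero_le) ?_
    intro n
    have := convPow_prob F n
    refine (measure_mono Set.inter_subset_right).trans ?_
    rw [Measure.conv_comm, ← lintegral_indicator_one measurableSet_Iic, Measure.lintegral_conv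
      (measurable_one.indicator measurableSet_Iic)]
    apply lintegral_mono
    intro y
    have : ∀ x, (Set.Iic (i:ℝ)).indicator (1 : ℝ → ℝ≥0∞) (y + x)
        = (Set.Iic ((i:ℝ) - y)).indicator 1 x := by
      intro x
      have : y + x ≤ i ↔ x ≤ i - y := by constructor <;> intro h <;> linarith
      simp [Set.indicator_apply, this]
    simp_rw [this]
    rw [lintegral_indicator_one measurableSet_Iic, Measure.restrict_apply measurableSet_Iic,
      Set.inter_comm, Set.Ici_inter_Iic, Real.volume_Icc, sub_zero]
  have h3 := h1.add h2
  rw [add_zero] at h3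
  refine tendsto_nhds_unique ?_ h3
  apply tendsto_const_nhds.congr
  intro n
  conv_lhs => rw [leb_iter ν F h n]
  rw [Measure.add_apply, Measure.finsetSum_apply]


lemma renewalCount_measurable (t : ℝ) : Measurable (fun x : ℕ → ℝ => renewalCount x t) := by
  have hset : ∀ n : ℕ, MeasurableSet {x : ℕ → ℝ | ∑ i ∈ Finset.range n, x i ≤ t} := by
    intro n
    apply measurableSet_le _ measurable_const
    fun_prop
  apply measurable_of_Iic
  intro m
  have e : (fun x : ℕ → ℝ => renewalCount x t) ⁻¹' Set.Iic m =
      {x | (∃ B : ℕ, ∀ n : ℕ, ∑ i ∈ Finset.range n, x i ≤ t → n ≤ B) →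
        ∀ n : ℕ, ∑ i ∈ Finset.range n, x i ≤ t → n ≤ m} := by
    ext x
    simp only [Set.mem_preimage, Set.mem_Iic, Set.mem_ofPred_eq, renewalCount]
    constructor
    · rintro h ⟨B, hB⟩ n hn
      exact (le_csSup ⟨B, fun n hn => hB n hn⟩ hn).trans h
    · intro h
      by_cases hb : BddAbove {n : ℕ | ∑ i ∈ Finset.range n, x i ≤ t}
      · obtain ⟨B, hB⟩ := hb
        rcases Set.eq_empty_or_nonempty {n : ℕ | ∑ i ∈ Finset.range n, x i ≤ t} with h0 | h0
        · rw [h0]; simp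
        · exact csSup_le h0 (h ⟨B, fun n hn => hB hn⟩)
      · rw [Nat.sSup_of_not_bddAbove hb]; exact Nat.zero_le _
  rw [e]
  rw [measurableSet_setOfPred]
  have hn : ∀ n B : ℕ, Measurable (fun x : ℕ → ℝ => ∑ i ∈ Finset.range n, x i ≤ t → n ≤ B) :=
    fun n B => (measurableSet_setOfPred.1 (hset n)).imp measurable_const
  exact (Measurable.exists fun B => Measurable.forall fun n => hn n B).imp
    (Measurable.forall fun n => hn n m)

lemma le_renewalCount_iff (x : ℕ → ℝ) (hx : ∀ i, 0 ≤ x i)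
    (hlim : Filter.Tendsto (fun n => ∑ i ∈ Finset.range n, x i) Filter.atTop Filter.atTop)
    (t : ℝ) (ht : 0 ≤ t) (n : ℕ) :
    n ≤ renewalCount x t ↔ ∑ i ∈ Finset.range n, x i ≤ t := by
  have hmono : Monotone (fun n => ∑ i ∈ Finset.range n, x i) := by
    apply monotone_nat_of_le_succ
    intro n
    rw [Finset.sum_range_succ]
    linarith [hx n]
  have hbdd : BddAbove {n : ℕ | ∑ i ∈ Finset.range n, x i ≤ t} := by
    obtain ⟨B, hB⟩ := (hlim.eventually_gt_atTop t).exists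
    refine ⟨B, fun n hn => ?_⟩
    by_contra hcon
    have h1 : ∑ i ∈ Finset.range B, x i ≤ ∑ i ∈ Finset.range n, x i := hmono (by omega)
    have h2 : ∑ i ∈ Finset.range n, x i ≤ t := hn
    linarith
  constructor
  · intro h
    have hmem : renewalCount x t ∈ {n : ℕ | ∑ i ∈ Finset.range n, x i ≤ t} :=
      Nat.sSup_mem ⟨0, by simpa using ht⟩ hbdd
    exact (hmono h).trans hmem
  · intro h
    exact le_csSup hbdd h

lemma count_aux (x : ℕ → ℝ) (hx : ∀ i, 0 ≤ x i)
    (hlim : Filter.Tendsto (fun n => ∑ i ∈ Finset.range n, x i) Filter.atTop Filter.atTop)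
    (s t : ℝ) (hs : 0 ≤ s) (ht : 0 ≤ t) (p : ℕ) :
    ∑' n : ℕ, ({q : ℝ × ℝ | s < q.1 ∧ q.1 + q.2 ≤ s + t}).indicator (fun _ => (1 : ℝ≥0∞))
      (∑ i ∈ Finset.range (n + 1), x i, ∑ i ∈ Finset.range p, x (n + 1 + i))
    = ((renewalCount x (s + t) - renewalCount x s - p : ℕ) : ℝ≥0∞) := by
  have h1 := le_renewalCount_iff x hx hlim s hs
  have h2 := le_renewalCount_iff x hx hlim (s + t) (by linarith)
  have e : ∀ n : ℕ, ({q : ℝ × ℝ | s < q.1 ∧ q.1 + q.2 ≤ s + t}).indicator (fun _ => (1 : ℝ≥0∞))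
      (∑ i ∈ Finset.range (n + 1), x i, ∑ i ∈ Finset.range p, x (n + 1 + i))
      = if n ∈ Finset.Ico (renewalCount x s) (renewalCount x (s + t) - p) then 1 else 0 := by
    intro n
    rw [Set.indicator_apply]
    congr 1
    rw [Set.mem_ofPred_eq, ← Finset.sum_range_add, ← h2, ← not_le, ← h1, Finset.mem_Ico]
    apply propext
    omega
  simp_rw [e]
  rw [tsum_eq_sum (s := Finset.Ico (renewalCount x s) (renewalCount x (s + t) - p))]
  · rw [Finset.sum_ite_mem, Finset.inter_self]
    simp only [Finset.sum_const, Nat.card_Ico, nsmul_eq_mul, mul_one]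
    congr 1
    omega
  · intro n hn
    rw [if_neg hn]

section single
variable {Ω : Type*} [MeasurableSpace Ω] {μ : Measure Ω} [IsProbabilityMeasure μ]

lemma growth (S : Ω → ℝ) (hSmeas : Measurable S) 
    (hES : ∫ ω, S ω ∂μ = 1) (ξ : ℕ → Ω → ℝ) (hmeas : ∀ j, Measurable (ξ j))
    (hind : iIndepFun ξ μ) (hlaw : ∀ j, μ.map (ξ (j + 1)) = μ.map S) :
    ∀ᵐ ω ∂μ, Filter.Tendsto (fun n => ∑ i ∈ Finset.range n, ξ (i + 1) ω)
      Filter.atTop Filter.atTop := by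
  have hid : ∀ j, IdentDistrib (ξ (j + 1)) S μ μ :=
    fun j => ⟨(hmeas _).aemeasurable, hSmeas.aemeasurable, hlaw j⟩
  have hint : Integrable S μ := by
    by_contra h
    rw [integral_undef h] at hES
    norm_num at hES
  have := strong_law_ae_real (fun i => ξ (i + 1)) ((hid 0).integrable_iff.2 hint)
    (fun i j hij => hind.indepFun (by simpa using hij))
    (fun i => (hid i).trans (hid 0).symm)
  filter_upwards [this] with ω hω
  rw [(hid 0).integral_eq, hES] at hω
  have h2 := hω.pos_mul_atTop one_pos (tendsto_natCast_atTop_atTop (R := ℝ))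
  refine h2.congr' ?_
  filter_upwards [Filter.eventually_gt_atTop 0] with n hn
  have : (n : ℝ) ≠ 0 := by positivity
  field_simp

lemma map_block (F : Measure ℝ) [IsProbabilityMeasure F] (ξ : ℕ → Ω → ℝ)
    (hmeas : ∀ j, Measurable (ξ j))
    (hind : iIndepFun ξ μ) (hlaw : ∀ j, μ.map (ξ (j + 1)) = F) (n p : ℕ) :
    μ.map (fun ω => ∑ i ∈ Finset.range p, ξ (n + 1 + i) ω) = convPow F p := by
  induction p with
  | zero => simp [convPow]
  | succ p ih =>
    have hi : iIndepFun (fun i => ξ (n + 1 + i)) μ :=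
      hind.precomp (g := fun i => n + 1 + i) (fun a b h => by simpa using h)
    have h1 := hi.indepFun_sum_range_succ (fun i => hmeas _) p
    have e : (fun ω => ∑ i ∈ Finset.range (p + 1), ξ (n + 1 + i) ω)
        = (∑ i ∈ Finset.range p, ξ (n + 1 + i)) + ξ (n + 1 + p) := by
      ext ω; simp [Finset.sum_range_succ]
    have e2 : (fun ω => ∑ i ∈ Finset.range p, ξ (n + 1 + i) ω)
        = ∑ i ∈ Finset.range p, ξ (n + 1 + i) := by
      ext ω; simp
    rw [e, IndepFun.map_add_eq_map_conv_map (by fun_prop) (hmeas _) h1, ← e2, ih]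
    have : n + 1 + p = (n + p) + 1 := by omega
    rw [this, hlaw]
    rfl

lemma map_T (F : Measure ℝ) [IsProbabilityMeasure F] (ξ : ℕ → Ω → ℝ)
    (hmeas : ∀ j, Measurable (ξ j))
    (hind : iIndepFun ξ μ) (hlaw : ∀ j, μ.map (ξ (j + 1)) = F) (n : ℕ) :
    μ.map (fun ω => ∑ i ∈ Finset.range (n + 1), ξ i ω)
      = Measure.conv (μ.map (ξ 0)) (convPow F n) := by
  have : IsProbabilityMeasure (μ.map (ξ 0)) := Measure.isProbabilityMeasure_map (hmeas 0).aemeasurable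
  induction n with
  | zero => simp [convPow]
  | succ n ih =>
    have := convPow_prob F n
    have h1 := hind.indepFun_sum_range_succ (fun i => hmeas _) (n + 1)
    have e : (fun ω => ∑ i ∈ Finset.range (n + 1 + 1), ξ i ω)
        = (∑ i ∈ Finset.range (n + 1), ξ i) + ξ (n + 1) := by
      ext ω; simp [Finset.sum_range_succ]
    have e2 : (fun ω => ∑ i ∈ Finset.range (n + 1), ξ i ω)
        = ∑ i ∈ Finset.range (n + 1), ξ i := by
      ext ω; simp
    rw [e, IndepFun.map_add_eq_map_conv_map (by fun_prop) (hmeas _) h1, ← e2, ih, hlaw,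
      Measure.conv_assoc]
    rfl

lemma map_pair (F : Measure ℝ) [IsProbabilityMeasure F] (ξ : ℕ → Ω → ℝ)
    (hmeas : ∀ j, Measurable (ξ j))
    (hind : iIndepFun ξ μ) (hlaw : ∀ j, μ.map (ξ (j + 1)) = F) (n p : ℕ) :
    μ.map (fun ω => (∑ i ∈ Finset.range (n + 1), ξ i ω, ∑ i ∈ Finset.range p, ξ (n + 1 + i) ω))
      = (Measure.conv (μ.map (ξ 0)) (convPow F n)).prod (convPow F p) := by
  rw [← map_T F ξ hmeas hind hlaw n, ← map_block F ξ hmeas hind hlaw n p]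
  have hd : Disjoint (Finset.range (n + 1)) (Finset.Ico (n + 1) (n + 1 + p)) := by
    rw [Finset.disjoint_left]; intro a; simp; omega
  have h := hind.indepFun_finset _ _ hd hmeas
  have h2 := h.comp (φ := fun v => ∑ i, v i) (ψ := fun v => ∑ i, v i)
    (by fun_prop) (by fun_prop)
  have h3 : IndepFun (fun ω => ∑ i ∈ Finset.range (n + 1), ξ i ω)
      (fun ω => ∑ i ∈ Finset.range p, ξ (n + 1 + i) ω) μ := by
    convert h2 using 1
    · ext ω
      exact (Finset.sum_coe_sort (Finset.range (n + 1)) (fun i => ξ i ω)).symm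
    · ext ω
      have := (Finset.sum_coe_sort (Finset.Ico (n + 1) (n + 1 + p)) (fun i => ξ i ω))
      rw [Finset.sum_Ico_eq_sum_range] at this
      simp only [Nat.add_sub_cancel_left] at this
      exact this.symm
  rw [h3.map_prod_eq_prod_map_map]
  · exact Measurable.aemeasurable (by fun_prop)
  · exact Measurable.aemeasurable (by fun_prop)

lemma lim_aux (S : Ω → ℝ) (hSmeas : Measurable S) 
    (hES : ∫ ω, S ω ∂μ = 1) (ξ : ℕ → Ω → ℝ) (hmeas : ∀ j, Measurable (ξ j))
    (hnn : ∀ j, ∀ᵐ ω ∂μ, 0 ≤ ξ j ω)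
    (hind : iIndepFun ξ μ) (hlaw : ∀ j, μ.map (ξ (j + 1)) = μ.map S) (t : ℝ) :
    Filter.Tendsto (fun n => ∫⁻ x, ENNReal.ofReal (t - x) ∂(convPow (μ.map S) n))
      Filter.atTop (nhds 0) := by
  have : IsProbabilityMeasure (μ.map S) := Measure.isProbabilityMeasure_map hSmeas.aemeasurable
  have e : ∀ n, ∫⁻ x, ENNReal.ofReal (t - x) ∂(convPow (μ.map S) n)
      = ∫⁻ ω, ENNReal.ofReal (t - ∑ i ∈ Finset.range n, ξ (0 + 1 + i) ω) ∂μ := by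
    intro n
    rw [← map_block (μ.map S) ξ hmeas hind hlaw 0 n, lintegral_map (by fun_prop) (by fun_prop)]
  simp_rw [e]
  have h := tendsto_lintegral_of_dominated_convergence (μ := μ)
    (F := fun n ω => ENNReal.ofReal (t - ∑ i ∈ Finset.range n, ξ (0 + 1 + i) ω))
    (f := fun _ => 0) (fun _ => ENNReal.ofReal t) (fun n => by fun_prop) ?_ (by simp) ?_
  · simpa using h
  · intro n
    filter_upwards [ae_all_iff.2 hnn] with ω hω
    apply ENNReal.ofReal_le_ofReal
    have : 0 ≤ ∑ i ∈ Finset.range n, ξ (0 + 1 + i) ω := Finset.sum_nonneg (fun i _ => hω _)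
    linarith
  · filter_upwards [growth S hSmeas hES ξ hmeas hind hlaw] with ω hω
    apply tendsto_const_nhds.congr'
    filter_upwards [hω.eventually_ge_atTop t] with n hn
    symm
    apply ENNReal.ofReal_of_nonpos
    have : ∑ i ∈ Finset.range n, ξ (0 + 1 + i) ω = ∑ i ∈ Finset.range n, ξ (i + 1) ω := by
      apply Finset.sum_congr rfl; intro i _; congr 1; omega
    linarith


lemma single_expect (S : Ω → ℝ) (hSmeas : Measurable S)
    (hES : ∫ ω, S ω ∂μ = 1) (ξ : ℕ → Ω → ℝ) (hmeas : ∀ j, Measurable (ξ j))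
    (hnn : ∀ j, ∀ᵐ ω ∂μ, 0 ≤ ξ j ω)
    (hind : iIndepFun ξ μ) (hlaw : ∀ j, μ.map (ξ (j + 1)) = μ.map S)
    (hgood : ∀ᵐ ω ∂μ, Filter.Tendsto (fun n => ∑ i ∈ Finset.range n, ξ i ω)
      Filter.atTop Filter.atTop)
    (hleb : volume.restrict (Set.Ici (0:ℝ)) = Measure.sum
      (fun k => Measure.conv (μ.map (ξ 0)) (convPow (μ.map S) k)))
    (s t : ℝ) (hs : 0 ≤ s) (ht : 0 ≤ t) (p : ℕ) :
    ∫⁻ ω, ((renewalCount (fun j => ξ j ω) (s + t) - renewalCount (fun j => ξ j ω) s - p : ℕ)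
      : ℝ≥0∞) ∂μ = ∫⁻ v, ENNReal.ofReal (t - v) ∂(convPow (μ.map S) p) := by
  have : IsProbabilityMeasure (μ.map S) := Measure.isProbabilityMeasure_map hSmeas.aemeasurable
  have : IsProbabilityMeasure (μ.map (ξ 0)) :=
    Measure.isProbabilityMeasure_map (hmeas 0).aemeasurable
  have hcp := convPow_prob (μ.map S)
  set E : Set (ℝ × ℝ) := {q : ℝ × ℝ | s < q.1 ∧ q.1 + q.2 ≤ s + t} with hE
  have hEm : MeasurableSet E := by
    apply MeasurableSet.inter
    · exact measurableSet_lt measurable_const measurable_fst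
    · exact measurableSet_le (measurable_fst.add measurable_snd) measurable_const
  have hEi : Measurable (E.indicator (fun _ => (1 : ℝ≥0∞))) := measurable_const.indicator hEm
  have hpm : ∀ n, Measurable (fun ω => (∑ i ∈ Finset.range (n + 1), ξ i ω,
      ∑ i ∈ Finset.range p, ξ (n + 1 + i) ω)) := by intro n; fun_prop
  calc _ = ∫⁻ ω, ∑' n : ℕ, E.indicator (fun _ => (1 : ℝ≥0∞))
          (∑ i ∈ Finset.range (n + 1), ξ i ω, ∑ i ∈ Finset.range p, ξ (n + 1 + i) ω) ∂μ := by
        apply lintegral_congr_ae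
        filter_upwards [hgood, ae_all_iff.2 hnn] with ω h1 h2
        exact (count_aux (fun j => ξ j ω) h2 h1 s t hs ht p).symm
    _ = ∑' n : ℕ, ∫⁻ ω, E.indicator (fun _ => (1 : ℝ≥0∞))
          (∑ i ∈ Finset.range (n + 1), ξ i ω, ∑ i ∈ Finset.range p, ξ (n + 1 + i) ω) ∂μ := by
        rw [lintegral_tsum]
        intro n
        exact (hEi.comp (hpm n)).aemeasurable
    _ = ∑' n : ℕ, ∫⁻ v, (Measure.conv (μ.map (ξ 0)) (convPow (μ.map S) n))
          ((fun u => (u, v)) ⁻¹' E) ∂(convPow (μ.map S) p) := by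
        congr 1
        ext n
        rw [← lintegral_map hEi (hpm n), map_pair (μ.map S) ξ hmeas hind hlaw n p]
        change ∫⁻ a, E.indicator 1 a ∂_ = _
        rw [lintegral_indicator_one hEm, Measure.prod_apply_symm hEm]
    _ = ∫⁻ v, ∑' n : ℕ, (Measure.conv (μ.map (ξ 0)) (convPow (μ.map S) n))
          ((fun u => (u, v)) ⁻¹' E) ∂(convPow (μ.map S) p) := by
        rw [lintegral_tsum]
        intro n
        exact (measurable_measure_prodMk_right hEm).aemeasurable
    _ = _ := by
        congr 1
        ext v
        have hEv : (fun u => (u, v)) ⁻¹' E = Set.Ioc s (s + t - v) := by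
          ext u
          have : u + v ≤ s + t ↔ u ≤ s + t - v := by constructor <;> intro h <;> linarith
          simp [hE, this]
        rw [hEv, ← Measure.sum_apply _ measurableSet_Ioc, ← hleb,
          Measure.restrict_apply measurableSet_Ioc]
        have : Set.Ioc s (s + t - v) ∩ Set.Ici 0 = Set.Ioc s (s + t - v) := by
          apply Set.inter_eq_left.2
          intro x hx
          exact hs.trans hx.1.le
        rw [this, Real.volume_Ioc]
        congr 1
        ring

lemma law_of_excess (D D' : Ω → ℕ) (hD : Measurable D) (hD' : Measurable D')
    (hfin : ∫⁻ ω, (D ω : ℝ≥0∞) ∂μ ≠ ⊤)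
    (h : ∀ p : ℕ, ∫⁻ ω, ((D ω - p : ℕ) : ℝ≥0∞) ∂μ = ∫⁻ ω, ((D' ω - p : ℕ) : ℝ≥0∞) ∂μ) :
    μ.map D = μ.map D' := by
  have step : ∀ (G : Ω → ℕ), Measurable G → ∀ p : ℕ, ∫⁻ ω, ((G ω - p : ℕ) : ℝ≥0∞) ∂μ
      = ∫⁻ ω, ((G ω - (p + 1) : ℕ) : ℝ≥0∞) ∂μ + (μ.map G) (Set.Ici (p + 1)) := by
    intro G hG p
    rw [Measure.map_apply hG measurableSet_Ici, ← lintegral_indicator_one (hG measurableSet_Ici),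
      ← lintegral_add_right _ (measurable_one.indicator (hG measurableSet_Ici))]
    congr 1
    ext ω
    by_cases hp : p + 1 ≤ G ω
    · have : G ω - p = (G ω - (p + 1)) + 1 := by omega
      simp [hp, this]
    · have h1 : G ω - p = 0 := by omega
      have h2 : G ω - (p + 1) = 0 := by omega
      simp [hp, h1, h2]
  have : IsProbabilityMeasure (μ.map D) := Measure.isProbabilityMeasure_map hD.aemeasurable
  have : IsProbabilityMeasure (μ.map D') := Measure.isProbabilityMeasure_map hD'.aemeasurable
  apply Measure.ext_of_Ici
  intro a
  rcases a with _ | p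
  · have : Set.Ici 0 = (Set.univ : Set ℕ) := by ext; simp
    simp [this]
  · have h1 := step D hD p
    rw [h p, step D' hD' p, h (p + 1)] at h1
    refine ((ENNReal.add_right_inj ?_).1 h1).symm
    rw [← h (p + 1)]
    refine ne_top_of_le_ne_top hfin (lintegral_mono fun ω => ?_)
    exact Nat.cast_le.2 (Nat.sub_le _ _)

/-- Stationarity of the increments of an equilibrium renewal process. -/
lemma stationary (S : Ω → ℝ) (hSmeas : Measurable S) (hSnn : ∀ᵐ ω ∂μ, 0 ≤ S ω)
    (hES : ∫ ω, S ω ∂μ = 1) (ξ : ℕ → Ω → ℝ) (hmeas : ∀ j, Measurable (ξ j))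
    (hnn : ∀ j, ∀ᵐ ω ∂μ, 0 ≤ ξ j ω)
    (hind : iIndepFun ξ μ) (hlaw : ∀ j, μ.map (ξ (j + 1)) = μ.map S)
    (heq : ∀ y : ℝ, 0 ≤ y →
      (μ {ω | y < ξ 0 ω}).toReal = ∫ z in Set.Ioi y, (μ {ω | z < S ω}).toReal)
    (s t : ℝ) (hs : 0 ≤ s) (ht : 0 ≤ t) :
    IdentDistrib (fun ω => renewalCount (fun j => ξ j ω) (s + t) - renewalCount (fun j => ξ j ω) s)
      (fun ω => renewalCount (fun j => ξ j ω) t) μ μ ∧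
    ∀ᵐ ω ∂μ, renewalCount (fun j => ξ j ω) s ≤ renewalCount (fun j => ξ j ω) (s + t) := by
  have : IsProbabilityMeasure (μ.map S) := Measure.isProbabilityMeasure_map hSmeas.aemeasurable
  have : IsProbabilityMeasure (μ.map (ξ 0)) :=
    Measure.isProbabilityMeasure_map (hmeas 0).aemeasurable
  have hmS : ∀ z, (μ.map S) (Set.Ioi z) = μ {ω | z < S ω} := fun z => by
    rw [Measure.map_apply hSmeas measurableSet_Ioi]; rfl
  have hmξ : ∀ z, (μ.map (ξ 0)) (Set.Ioi z) = μ {ω | z < ξ 0 ω} := fun z => by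
    rw [Measure.map_apply (hmeas 0) measurableSet_Ioi]; rfl
  have hint : Integrable S μ := by
    by_contra h
    rw [integral_undef h] at hES
    norm_num at hES
  have hdens : μ.map (ξ 0) = (volume.restrict (Set.Ici 0)).withDensity
      (fun x => (μ.map S) (Set.Ioi x)) := by
    apply nu0_eq
    · rw [Measure.map_apply (hmeas 0) measurableSet_Iio]
      have := hnn 0
      rw [ae_iff] at this
      convert this using 2
      ext ω; simp
    · simp_rw [hmS]
      rw [← lintegral_eq_lintegral_meas_lt μ hSnn hSmeas.aemeasurable,
        ← ofReal_integral_eq_lintegral_ofReal hint hSnn, hES, ENNReal.ofReal_one]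
    · intro y hy
      simp_rw [hmS, hmξ]
      exact heq y hy
  have hleb : volume.restrict (Set.Ici (0:ℝ)) = Measure.sum
      (fun k => Measure.conv (μ.map (ξ 0)) (convPow (μ.map S) k)) := by
    apply leb_sum
    · apply leb_eq _ _ hdens
      rw [Measure.map_apply hSmeas measurableSet_Iio]
      rw [ae_iff] at hSnn
      convert hSnn using 2
      ext ω; simp
    · exact lim_aux S hSmeas hES ξ hmeas hnn hind hlaw
  have hgood : ∀ᵐ ω ∂μ, Filter.Tendsto (fun n => ∑ i ∈ Finset.range n, ξ i ω)
      Filter.atTop Filter.atTop := by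
    filter_upwards [growth S hSmeas hES ξ hmeas hind hlaw] with ω hω
    rw [← Filter.tendsto_add_atTop_iff_nat 1]
    simp_rw [Finset.sum_range_succ']
    exact Filter.tendsto_atTop_add_const_right _ _ hω
  have hzero : ∀ᵐ ω ∂μ, 0 < ξ 0 ω := by
    rw [ae_iff]
    have h0 : (μ.map (ξ 0)) (Set.Iic 0) = 0 := by
      rw [hdens, withDensity_apply _ measurableSet_Iic,
        Measure.restrict_restrict measurableSet_Iic, Set.inter_comm, Set.Ici_inter_Iic]
      simp
    rw [Measure.map_apply (hmeas 0) measurableSet_Iic] at h0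
    convert h0 using 2
    ext ω; simp
  have hNm : ∀ u : ℝ, Measurable (fun ω => renewalCount (fun j => ξ j ω) u) := fun u =>
    (renewalCount_measurable u).comp (measurable_pi_lambda _ hmeas)
  have hexp := single_expect S hSmeas hES ξ hmeas hnn hind hlaw hgood hleb
  have hN0 : ∀ᵐ ω ∂μ, renewalCount (fun j => ξ j ω) 0 = 0 := by
    filter_upwards [hgood, ae_all_iff.2 hnn, hzero] with ω h1 h2 h3
    have := le_renewalCount_iff (fun j => ξ j ω) h2 h1 0 le_rfl 1
    simp only [Finset.sum_range_one] at this
    by_contra hc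
    have := this.1 (by omega)
    linarith
  refine ⟨⟨((hNm _).sub (hNm _)).aemeasurable, (hNm _).aemeasurable, ?_⟩, ?_⟩
  · apply law_of_excess (fun ω => renewalCount (fun j => ξ j ω) (s + t)
      - renewalCount (fun j => ξ j ω) s) _ ((hNm _).sub (hNm _)) (hNm _)
    · have := hexp s t hs ht 0
      simp only [tsub_zero] at this
      rw [this]
      simp [convPow]
    · intro p
      rw [hexp s t hs ht p, ← hexp 0 t le_rfl ht p]
      apply lintegral_congr_ae
      filter_upwards [hN0] with ω h
      rw [h, zero_add, tsub_zero]
  · filter_upwards [hgood, ae_all_iff.2 hnn] with ω h1 h2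
    rw [le_renewalCount_iff (fun j => ξ j ω) h2 h1 (s + t) (by linarith)]
    have := (le_renewalCount_iff (fun j => ξ j ω) h2 h1 s hs _).1 le_rfl
    linarith

end single

lemma indep_rows {Ω : Type*} [MeasurableSpace Ω] {μ : Measure Ω} [IsProbabilityMeasure μ]
    (ξ : ℕ → ℕ → Ω → ℝ) (hξmeas : ∀ i j, Measurable (ξ i j))
    (hindep : iIndepFun (fun p : ℕ × ℕ => ξ p.1 p.2) μ) :
    iIndepFun (fun i ω => (fun j => ξ i j ω)) μ := by
  have : ∀ i j, IsProbabilityMeasure (μ.map (ξ i j)) :=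
    fun i j => Measure.isProbabilityMeasure_map (hξmeas i j).aemeasurable
  have hrow : ∀ i, iIndepFun (ξ i) μ := fun i =>
    hindep.precomp (g := fun j => (i, j)) (fun a b h => by simpa using h)
  rw [iIndepFun_iff_map_fun_eq_infinitePi_map (fun i => measurable_pi_lambda _ (hξmeas i))]
  have h1 := (iIndepFun_iff_map_fun_eq_infinitePi_map (fun p : ℕ × ℕ => hξmeas p.1 p.2)).1 hindep
  have h2 : ∀ i, μ.map (fun ω j => ξ i j ω) = Measure.infinitePi (fun j => μ.map (ξ i j)) :=
    fun i => (iIndepFun_iff_map_fun_eq_infinitePi_map (hξmeas i)).1 (hrow i)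
  simp_rw [h2]
  rw [← Measure.infinitePi_map_curry (fun i j => μ.map (ξ i j)), ← h1, Measure.map_map]
  · rfl
  · fun_prop
  · exact measurable_pi_lambda _ (fun p => hξmeas p.1 p.2)


/-- Tail bound, over sets of consecutive integer times, for the maximum of the centered
pooled process `|n' j - ∑_{i=1}^{n'} N_i(j)|`, where the `N_i` are the counting processes
of i.i.d. equilibrium renewal processes with renewal distribution `S`, `E[S] = 1`.
Here `ξ i 0` is the first (equilibrium-distributed) renewal interval of the `i`-th
process and `ξ i (j+1)` its subsequent intervals, distributed as `S`, all jointly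
independent. -/
theorem pooled_maximal_integer_times
    {Ω : Type*} [MeasurableSpace Ω] (μ : Measure Ω) [IsProbabilityMeasure μ]
    (S : Ω → ℝ) (hSmeas : Measurable S) (hSnn : ∀ᵐ ω ∂μ, 0 ≤ S ω)
    (hES : ∫ ω, S ω ∂μ = 1)
    (ξ : ℕ → ℕ → Ω → ℝ)
    (hξmeas : ∀ i j, Measurable (ξ i j))
    (hξnn : ∀ i j, ∀ᵐ ω ∂μ, 0 ≤ ξ i j ω)
    (hindep : iIndepFun (fun p : ℕ × ℕ => ξ p.1 p.2) μ)
    (hlaw : ∀ i j, μ.map (ξ i (j + 1)) = μ.map S)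
    (heq : ∀ i, ∀ y : ℝ, 0 ≤ y →
      (μ {ω | y < ξ i 0 ω}).toReal = ∫ z in Set.Ioi y, (μ {ω | z < S ω}).toReal)
    (n' : ℕ) (hn' : 1 ≤ n')
    (C₁ s₁ r₁ : ℝ) (hC₁ : 0 < C₁) (hs₁ : 1 < s₁) (hr₁ : s₁ ≤ r₁)
    (hmom : ∀ t : ℝ, 1 ≤ t →
      ∫⁻ ω, ENNReal.ofReal
          (|(∑ i ∈ Finset.range n', (renewalCount (fun j => ξ i j ω) t : ℝ)) - (n' : ℝ) * t| ^ r₁) ∂μ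
        ≤ ENNReal.ofReal (C₁ * (n' : ℝ) ^ (r₁ / 2) * t ^ s₁)) :
    ∀ k : ℕ, ∀ lam : ℝ, 0 < lam →
      (μ {ω | ∃ j : ℕ, 1 ≤ j ∧ j ≤ k ∧
          lam ≤ |(n' : ℝ) * (j : ℝ)
            - ∑ i ∈ Finset.range n', (renewalCount (fun j' => ξ i j' ω) (j : ℝ) : ℝ)|}).toReal
        ≤ (6 * (r₁ + 1) / (s₁ - 1)) ^ (r₁ + 1) * C₁ * (n' : ℝ) ^ (r₁ / 2)
            * (k : ℝ) ^ s₁ * lam ^ (-r₁) := by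
  intro k lam hlam
  have hnmul : (0:ℝ) < (n' : ℝ) := by exact_mod_cast hn'
  have hrows := indep_rows ξ hξmeas hindep
  have hNm : ∀ (i : ℕ) (u : ℝ), Measurable (fun ω => renewalCount (fun j => ξ i j ω) u) :=
    fun i u => (renewalCount_measurable u).comp (measurable_pi_lambda _ (hξmeas i))
  have hstat : ∀ i : ℕ, ∀ s t : ℝ, 0 ≤ s → 0 ≤ t → _ := fun i s t hs ht =>
    stationary S hSmeas hSnn hES (ξ i) (hξmeas i) (hξnn i)
      (hindep.precomp (g := fun j => (i, j)) (fun a b h => by simpa using h))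
      (hlaw i) (heq i) s t hs ht
  set X : ℕ → Ω → ℝ := fun j ω => if j = 0 then 0 else
    (∑ i ∈ Finset.range n', (renewalCount (fun j' => ξ i j' ω) (j : ℝ) : ℝ)) - (n' : ℝ) * (j : ℝ)
    with hXdef
  have hcast : ∀ (i : ℕ) (u : ℝ),
      Measurable (fun ω => (renewalCount (fun j => ξ i j ω) u : ℝ)) :=
    fun i u => measurable_from_top.comp (hNm i u)
  have hXm : ∀ j, Measurable (X j) := by
    intro j
    by_cases hj : j = 0
    · simp only [hXdef, hj, if_true]; exact measurable_const
    · simp only [hXdef, hj, if_false]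
      exact (Finset.measurable_sum _ (fun i _ => hcast i _)).sub measurable_const
  have hmax := maximal_ineq μ X hXm (by simp [hXdef]) (A := C₁ * (n' : ℝ) ^ (r₁ / 2))
    (by positivity) hs₁ hr₁ ?_ k lam hlam
  · have hset : {ω | ∃ j : ℕ, 1 ≤ j ∧ j ≤ k ∧ lam ≤ |(n' : ℝ) * (j : ℝ)
            - ∑ i ∈ Finset.range n', (renewalCount (fun j' => ξ i j' ω) (j : ℝ) : ℝ)|}
        = {ω | ∃ j : ℕ, 1 ≤ j ∧ j ≤ k ∧ lam ≤ |X j ω|} := by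
      ext ω
      simp only [Set.mem_ofPred_eq]
      refine exists_congr fun j => and_congr_right fun hj => ?_
      have : j ≠ 0 := by omega
      simp only [hXdef, this, if_false]
      rw [abs_sub_comm]
    rw [hset]
    have h6 : 0 ≤ 6 * (r₁ + 1) / (s₁ - 1) := div_nonneg (by linarith) (by linarith)
    refine (ENNReal.toReal_le_of_le_ofReal (by positivity) hmax).trans (le_of_eq ?_)
    ring
  · intro i j hj
    have hj0 : j ≠ 0 := by omega
    have hj1 : (1:ℝ) ≤ (j:ℝ) := by exact_mod_cast hj
    refine le_trans (le_of_eq ?_) (hmom j hj1)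
    by_cases hi : i = 0
    · simp [hXdef, hi, hj0]
    · have hij : i + j ≠ 0 := by omega
      have hid := IdentDistrib.pi (ι := ℕ)
        (fun m => (hstat m i j (Nat.cast_nonneg _) (Nat.cast_nonneg _)).1)
        (hrows.comp (fun _ x => renewalCount x ((i:ℝ) + j) - renewalCount x (i:ℝ))
          (fun _ => (renewalCount_measurable _).sub (renewalCount_measurable _)))
        (hrows.comp (fun _ x => renewalCount x (j:ℝ)) (fun _ => renewalCount_measurable _))
      have hg : Measurable (fun v : ℕ → ℕ => ENNReal.ofReal
          (|(∑ m ∈ Finset.range n', (v m : ℝ)) - (n' : ℝ) * (j:ℝ)| ^ r₁)) := by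
        have : ∀ m : ℕ, Measurable (fun v : ℕ → ℕ => (v m : ℝ)) :=
          fun m => measurable_from_top.comp (measurable_pi_apply m)
        have : Measurable (fun v : ℕ → ℕ => ∑ m ∈ Finset.range n', (v m : ℝ)) :=
          Finset.measurable_sum _ (fun m _ => this m)
        fun_prop
      have heqi := (hid.comp hg).lintegral_eq
      refine Eq.trans ?_ heqi
      apply lintegral_congr_ae
      filter_upwards [ae_all_iff.2 (fun m =>
        (hstat m i j (Nat.cast_nonneg _) (Nat.cast_nonneg _)).2)] with ω hω
      simp only [hXdef, hi, hij, if_false, Function.comp]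
      congr 3
      simp_rw [Nat.cast_sub (hω _)]
      rw [Finset.sum_sub_distrib]
      push_cast
      ring
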